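/- For every natural number k and all real numbers t ≤ t', the k-dimensional Lebesgue measure of the ordered simplex {(t₁,…,t_k) ∈ ℝ^k : t ≤ t₁ ≤ t₂ ≤ … ≤ t_k ≤ t'} equals (t'−t)^k / k!. -/

import Mathlib

/-- The `k`-dimensional Lebesgue measure of the ordered simplex
`{(t₁,…,t_k) : t ≤ t₁ ≤ t₂ ≤ … ≤ t_k ≤ t'}` equals `(t'−t)^k / k!`. -/
theorem ordered_simplex_volume (k : ℕ) (t t' : ℝ) (h : t ≤ t') :
    MeasureTheory.volume
      {x : Fin k → ℝ | (∀ i, t ≤ x i ∧ x i ≤ t') ∧ ∀ i j : Fin k, i ≤ j → x i ≤ x j}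
      = ENNReal.ofReal ((t' - t) ^ k / (Nat.factorial k)) := by
  induction k generalizing t with
  | zero => simp [MeasureTheory.volume_pi]
  | succ k ih =>
    have hmeas : MeasurableSet {x : Fin (k+1) → ℝ | (∀ i, t ≤ x i ∧ x i ≤ t') ∧
        ∀ i j : Fin (k+1), i ≤ j → x i ≤ x j} := by
      apply IsClosed.measurableSet
      simp only [Set.ofPred_and, Set.ofPred_forall]
      refine IsClosed.inter (isClosed_iInter fun i => IsClosed.inter ?_ ?_)
        (isClosed_iInter fun i => isClosed_iInter fun j => isClosed_iInter fun _ => ?_)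
      · exact isClosed_le (by fun_prop) (by fun_prop)
      · exact isClosed_le (by fun_prop) (by fun_prop)
      · exact isClosed_le (by fun_prop) (by fun_prop)
    have hmp := (MeasureTheory.volume_preserving_piFinSuccAbove (fun _ : Fin (k+1) => ℝ) 0).symm
    rw [← hmp.measure_preimage hmeas.nullMeasurableSet, MeasureTheory.Measure.volume_eq_prod,
      MeasureTheory.Measure.prod_apply (hmp.measurable hmeas)]
    have key : ∀ a : ℝ, MeasureTheory.volume (Prod.mk a ⁻¹'
        ((MeasurableEquiv.piFinSuccAbove (fun _ : Fin (k+1) => ℝ) 0).symm ⁻¹'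
        {x : Fin (k+1) → ℝ | (∀ i, t ≤ x i ∧ x i ≤ t') ∧
        ∀ i j : Fin (k+1), i ≤ j → x i ≤ x j})) =
        (Set.Icc t t').indicator
          (fun a => ENNReal.ofReal ((t' - a) ^ k / (Nat.factorial k))) a := by
      intro a
      by_cases ha : a ∈ Set.Icc t t'
      · rw [Set.indicator_of_mem ha, ← ih a ha.2]
        congr 1
        ext y
        simp only [Set.mem_preimage, Set.mem_ofPred_eq, MeasurableEquiv.piFinSuccAbove_symm_apply,
          Fin.insertNthEquiv_zero, Fin.consEquiv_apply, Fin.forall_fin_succ, Fin.cons_zero,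
          Fin.cons_succ, Fin.succ_le_succ_iff]
        constructor
        · rintro ⟨⟨_, h1⟩, ⟨_, h2⟩, h3⟩
          exact ⟨fun i => ⟨h2 i (Fin.zero_le _), (h1 i).2⟩, fun i => (h3 i).2⟩
        · rintro ⟨h1, h2⟩
          refine ⟨⟨ha, fun i => ⟨ha.1.trans (h1 i).1, (h1 i).2⟩⟩, ⟨fun _ => le_rfl, 
            fun i _ => (h1 i).1⟩, fun i => ⟨fun hi => ?_, h2 i⟩⟩
          exact absurd hi (by simp)
      · rw [Set.indicator_of_notMem ha]
        convert MeasureTheory.measure_empty (μ := (MeasureTheory.volume : MeasureTheory.Measure (Fin k → ℝ)))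
        ext y
        simp only [Set.mem_preimage, Set.mem_ofPred_eq, MeasurableEquiv.piFinSuccAbove_symm_apply,
          Fin.insertNthEquiv_zero, Fin.consEquiv_apply, Fin.forall_fin_succ, Fin.cons_zero,
          Set.mem_empty_iff_false, iff_false]
        exact fun hh => ha hh.1.1
    rw [MeasureTheory.lintegral_congr key, MeasureTheory.lintegral_indicator measurableSet_Icc,
      ← MeasureTheory.ofReal_integral_eq_lintegral_ofReal]
    · congr 1
      rw [MeasureTheory.integral_Icc_eq_integral_Ioc, ← intervalIntegral.integral_of_le h,
        intervalIntegral.integral_div,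
        intervalIntegral.integral_comp_sub_left (fun x => x ^ k) t', integral_pow,
        Nat.factorial_succ]
      have := Nat.factorial_ne_zero k
      push_cast
      field_simp
      simp
    · exact (Continuous.continuousOn (by fun_prop)).integrableOn_Icc
    · filter_upwards [MeasureTheory.ae_restrict_mem measurableSet_Icc] with a ha
      have : 0 ≤ t' - a := sub_nonneg.2 ha.2
      simp only [Pi.zero_apply]
      positivity
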